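/- Let q ≤ n, let f ∈ H_d^ℝ[q] be nonzero and x ∈ S^n be such that max{‖f(x)‖₂, σ_q(Δ⁻¹Dₓf)} > 0, and define Σ_{d,x} := { g ∈ H_d^ℝ[q] : g(x) = 0 and rank Dₓg < q } and dist∞(f, Σ_{d,x}) := inf{ ‖f − g‖∞ : g ∈ Σ_{d,x} }. Then ‖f‖∞ / dist∞(f, Σ_{d,x}) ≤ K(f,x) ≤ 2·(Σᵢ dᵢ²)^{1/2} · ‖f‖∞ / dist∞(f, Σ_{d,x}). Moreover, with Σ_d := ∪_{y∈S^n} Σ_{d,y} and K(f) := sup_{y∈S^n} K(f,y), the same two-sided bound holds: ‖f‖∞ / dist∞(f, Σ_d) ≤ K(f) ≤ 2·(Σᵢ dᵢ²)^{1/2} · ‖f‖∞ / dist∞(f, Σ_d). -/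

import Mathlib

open MvPolynomial

noncomputable def vnorm {m : ℕ} (v : Fin m → ℝ) : ℝ := Real.sqrt (∑ j, v j ^ 2)

noncomputable def polySupNorm {n q : ℕ} (f : Fin q → MvPolynomial (Fin (n + 1)) ℝ) : ℝ :=
  ⨆ x : {x : Fin (n + 1) → ℝ // vnorm x = 1}, ⨆ i : Fin q, |eval x.1 (f i)|

/-- The smallest singular value `σ_q(Δ⁻¹Dₓg)` of the scaled derivative of `g` at `x`
restricted to the tangent space `TₓSⁿ = x^⊥`. -/
noncomputable def sigmaMin {n q : ℕ} (d : Fin q → ℕ) (x : Fin (n + 1) → ℝ)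
    (g : Fin q → MvPolynomial (Fin (n + 1)) ℝ) : ℝ :=
  ⨅ u : {u : Fin q → ℝ // vnorm u = 1},
    ⨆ w : {w : Fin (n + 1) → ℝ // vnorm w ≤ 1 ∧ ∑ j, w j * x j = 0},
      |∑ i, u.1 i * ((d i : ℝ)⁻¹ * ∑ j, w.1 j * eval x (pderiv j (g i)))|

/-- `Φₓ(g) = max{‖g(x)‖₂, σ_q(Δ⁻¹Dₓg)}`. -/
noncomputable def Phi {n q : ℕ} (d : Fin q → ℕ) (x : Fin (n + 1) → ℝ)
    (g : Fin q → MvPolynomial (Fin (n + 1)) ℝ) : ℝ :=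
  max (vnorm fun i => eval x (g i)) (sigmaMin d x g)

/-- The local condition number `K(f,x) = √q ‖f‖∞ / max{‖f(x)‖₂, σ_q(Δ⁻¹Dₓf)}`,
with value `∞` when the denominator vanishes. -/
noncomputable def Kloc {n q : ℕ} (d : Fin q → ℕ) (x : Fin (n + 1) → ℝ)
    (f : Fin q → MvPolynomial (Fin (n + 1)) ℝ) : ENNReal :=
  ENNReal.ofReal (Real.sqrt q * polySupNorm f) / ENNReal.ofReal (Phi d x f)

/-- The global condition number `K(f) = sup_{y ∈ Sⁿ} K(f,y)`, with value `∞`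
when `f` has a singular zero. -/
noncomputable def Kglob {n q : ℕ} (d : Fin q → ℕ)
    (f : Fin q → MvPolynomial (Fin (n + 1)) ℝ) : ENNReal :=
  ⨆ y : {y : Fin (n + 1) → ℝ // vnorm y = 1}, Kloc d y.1 f

/-- The set `Σ_{d,x}` of systems in `H_d^ℝ[q]` having `x` as a singular zero: `g(x) = 0`
and `Dₓg : x^⊥ → ℝ^q` is not of full rank `q` (equivalently, some nonzero `u ∈ ℝ^q`
annihilates its range). -/
def SingularAt {n q : ℕ} (d : Fin q → ℕ) (x : Fin (n + 1) → ℝ) :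
    Set (Fin q → MvPolynomial (Fin (n + 1)) ℝ) :=
  {g | (∀ i, (g i).IsHomogeneous (d i)) ∧ (∀ i, eval x (g i) = 0) ∧
    ∃ u : Fin q → ℝ, u ≠ 0 ∧ ∀ w : Fin (n + 1) → ℝ, (∑ j, w j * x j = 0) →
      (∑ i, u i * ∑ j, w j * eval x (pderiv j (g i))) = 0}

/-- Distance, in the real `L∞`-norm, of `f` to a set `S` of systems. -/
noncomputable def distInf {n q : ℕ} (f : Fin q → MvPolynomial (Fin (n + 1)) ℝ)
    (S : Set (Fin q → MvPolynomial (Fin (n + 1)) ℝ)) : ℝ :=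
  sInf {t : ℝ | ∃ g ∈ S, t = polySupNorm (fun i => f i - g i)}

lemma ck_sign (v : ℕ → ℝ) (m i : ℕ) (hi : i ≤ m) (hv : ∀ a b, a < b → b ≤ m → v b < v a) :
    0 < (-1) ^ i * ∏ j ∈ (Finset.range (m + 1)).erase i, (v i - v j) := by
  have h₁ : 0 < ∏ j ∈ Finset.range i, ((-1) * (v i - v j)) :=
    Finset.prod_pos (fun j hj => mul_pos_of_neg_of_neg neg_one_lt_zero <| sub_neg.mpr <|
    hv j i (Finset.mem_range.mp hj) hi)
  rw [Finset.prod_mul_distrib, Finset.prod_const, Finset.card_range] at h₁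
  have h₂ : 0 < ∏ j ∈ Finset.Ioc i m, (v i - v j) :=
    Finset.prod_pos (fun j hj => sub_pos.mpr <|
      hv i j (Finset.mem_Ioc.mp hj).1 (Finset.mem_Ioc.mp hj).2)
  have union : (Finset.range (m + 1)).erase i = (Finset.range i) ∪ Finset.Ioc i m := by grind
  have disjoint : Disjoint (Finset.range i) (Finset.Ioc i m) := by grind [Finset.disjoint_iff_ne]
  rw [union, Finset.prod_union disjoint, ← mul_assoc]
  exact mul_pos h₁ h₂

lemma ck_lagrange (v : ℕ → ℝ) (m : ℕ) (hv : ∀ a b, a < b → b ≤ m → v b < v a)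
    (P : Polynomial ℝ) (hP : P.degree ≤ m) :
    P.eval 1 = ∑ i ∈ Finset.range (m + 1),
      (P.eval (v i) / ∏ j ∈ (Finset.range (m + 1)).erase i, (v i - v j)) *
        ∏ j ∈ (Finset.range (m + 1)).erase i, (1 - v j) := by
  have hinj : Set.InjOn v (Finset.range (m + 1)) := by
    intro a ha b hb hab
    simp only [Finset.coe_range, Set.mem_Iio] at ha hb
    rcases lt_trichotomy a b with h | h | h
    · have := hv a b h (by omega); linarith
    · exact h
    · have := hv b a h (by omega); linarith
  have hdeg : P.degree < (Finset.range (m + 1)).card := by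
    rw [Finset.card_range]
    exact lt_of_le_of_lt hP (by exact_mod_cast Nat.lt_succ_self m)
  conv_lhs => rw [Lagrange.eq_interpolate hinj hdeg, Lagrange.interpolate_eq_sum]
  simp [Polynomial.eval_finsetSum, Polynomial.eval_prod]

/-- Schur's inequality at the endpoint. -/
lemma ck_schur (m : ℕ) (P : Polynomial ℝ) (hP : P.degree ≤ m) (M : ℝ)
    (hM : ∀ θ : ℝ, |Real.sin θ * P.eval (Real.cos θ)| ≤ M) :
    |P.eval 1| ≤ (m + 1) * M := by
  set t : ℕ → ℝ := fun k => (2 * k + 1) * Real.pi / (2 * (m + 1)) with ht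
  set v : ℕ → ℝ := fun k => Real.cos (t k) with hvdef
  have hm : (0 : ℝ) < 2 * (m + 1) := by positivity
  have htpos : ∀ k, 0 < t k := fun k => by
    have := Real.pi_pos
    simp only [ht]; positivity
  have htlt : ∀ k, k ≤ m → t k < Real.pi := fun k hk => by
    have hk' : (k : ℝ) ≤ m := by exact_mod_cast hk
    simp only [ht]
    rw [div_lt_iff₀ hm]
    nlinarith [Real.pi_pos]
  have hv : ∀ a b, a < b → b ≤ m → v b < v a := by
    intro a b hab hb
    have hab' : (a : ℝ) < b := by exact_mod_cast hab
    apply Real.strictAntiOn_cos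
    · exact ⟨(htpos a).le, (htlt a (by omega)).le⟩
    · exact ⟨(htpos b).le, (htlt b hb).le⟩
    · simp only [ht]
      have := Real.pi_pos
      gcongr
  have hsin : ∀ k, k ≤ m → 0 < Real.sin (t k) := fun k hk =>
    Real.sin_pos_of_pos_of_lt_pi (htpos k) (htlt k hk)
  have hU : ∀ k, k ≤ m →
      (Polynomial.Chebyshev.U ℝ (m : ℤ)).eval (v k) * Real.sin (t k) = (-1) ^ k := by
    intro k hk
    simp only [hvdef]
    rw [Polynomial.Chebyshev.U_real_cos]
    have : (((m : ℤ) : ℝ) + 1) * t k = k * Real.pi + Real.pi / 2 := by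
      simp only [ht]; push_cast; field_simp
    rw [this, Real.sin_add_pi_div_two, Real.cos_nat_mul_pi]
  have hone : ∀ j ∈ Finset.range (m + 1), 0 ≤ 1 - v j := fun j _ => by
    have := Real.cos_le_one (t j); simp only [hvdef]; linarith
  have key := ck_lagrange v m hv (Polynomial.Chebyshev.U ℝ (m : ℤ))
    (by rw [Polynomial.Chebyshev.degree_U_natCast])
  rw [Polynomial.Chebyshev.U_eval_one] at key
  push_cast at key
  rw [ck_lagrange v m hv P hP, key, Finset.sum_mul]
  refine (Finset.abs_sum_le_sum_abs _ _).trans (Finset.sum_le_sum ?_)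
  intro i hi
  have him : i ≤ m := by simpa [Nat.lt_succ_iff] using hi
  set A := ∏ j ∈ (Finset.range (m + 1)).erase i, (v i - v j)
  set B := ∏ j ∈ (Finset.range (m + 1)).erase i, (1 - v j)
  have hB : 0 ≤ B := Finset.prod_nonneg fun j hj => hone j (Finset.mem_of_mem_erase hj)
  have hA : 0 < (-1) ^ i * A := ck_sign v m i him hv
  have hs := hsin i him
  have hPi := hM (t i)
  have hUi := hU i him
  have hsq : ((-1 : ℝ) ^ i) * (-1) ^ i = 1 := by simp [← mul_pow]
  have e1 : |A| = (-1) ^ i * A := by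
    rw [← abs_of_pos hA, abs_mul]; simp
  have hApos : 0 < |A| := by rw [e1]; exact hA
  have e2 : (Polynomial.Chebyshev.U ℝ (m : ℤ)).eval (v i) / A = 1 / (Real.sin (t i) * |A|) := by
    have hA0 : A ≠ 0 := abs_pos.mp hApos
    rw [div_eq_div_iff hA0 (by positivity), e1]
    calc _ = ((Polynomial.Chebyshev.U ℝ (m : ℤ)).eval (v i) * Real.sin (t i)) * (-1) ^ i * A := by ring
      _ = _ := by rw [hUi, hsq]
  rw [e2, abs_mul, abs_div, abs_of_nonneg hB]
  have e3 : |P.eval (v i)| ≤ M / Real.sin (t i) := by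
    rw [le_div_iff₀ hs]
    rw [abs_mul, abs_of_pos hs] at hPi
    linarith
  calc |P.eval (v i)| / |A| * B ≤ (M / Real.sin (t i)) / |A| * B := by gcongr
    _ = 1 / (Real.sin (t i) * |A|) * B * M := by field_simp


lemma ck_chain0 {n : ℕ} (φ : Fin (n + 1) → Polynomial ℝ) (h : MvPolynomial (Fin (n + 1)) ℝ) :
    Polynomial.derivative (aeval φ h) =
    ∑ j, Polynomial.derivative (φ j) * aeval φ (pderiv j h) := by
  induction h using MvPolynomial.induction_on with
  | C a => simp
  | add p q hp hq => simp [hp, hq, mul_add, Finset.sum_add_distrib]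
  | mul_X p i hp =>
    have e : ∀ j, aeval φ (pderiv j (p * X i)) =
        aeval φ (pderiv j p) * φ i + aeval φ p * (if i = j then 1 else 0) := by
      intro j
      rw [Derivation.leibniz, pderiv_X]
      by_cases hij : i = j
      · subst hij; simp; ring
      · have : (Pi.single j (1 : MvPolynomial (Fin (n + 1)) ℝ) : Fin (n + 1) → _) i = 0 := by
          rw [Pi.single_apply, if_neg hij]
        rw [this]; simp [hij]; ring
    simp only [e, map_mul, aeval_X, Polynomial.derivative_mul, hp, mul_add, Finset.sum_add_distrib]
    simp only [mul_ite, mul_one, mul_zero, Finset.sum_ite_eq, Finset.mem_univ, if_true,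
      Finset.sum_mul]
    congr 1
    · exact Finset.sum_congr rfl fun j _ => by ring
    · ring

/-- The line `x + T w`. -/
noncomputable def ckLine {n : ℕ} (x w : Fin (n + 1) → ℝ) : Fin (n + 1) → Polynomial ℝ :=
  fun j => Polynomial.C (x j) + Polynomial.C (w j) * Polynomial.X

lemma ck_eval_aeval {n : ℕ} (x w : Fin (n + 1) → ℝ) (h : MvPolynomial (Fin (n + 1)) ℝ) (T : ℝ) :
    (aeval (ckLine x w) h).eval T = eval (fun j => x j + T * w j) h := by
  induction h using MvPolynomial.induction_on with
  | C a => simp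
  | add p q hp hq => simp [hp, hq]
  | mul_X p i hp =>
    rw [map_mul, aeval_X, Polynomial.eval_mul, hp, map_mul, eval_X]
    simp [ckLine]; left; ring

lemma ck_coeff_one {n : ℕ} (x w : Fin (n + 1) → ℝ) (h : MvPolynomial (Fin (n + 1)) ℝ) :
    (aeval (ckLine x w) h).coeff 1 = ∑ j, w j * eval x (pderiv j h) := by
  have h1 : (aeval (ckLine x w) h).coeff 1 =
      (Polynomial.derivative (aeval (ckLine x w) h)).eval 0 := by
    rw [← Polynomial.coeff_zero_eq_eval_zero, Polynomial.coeff_derivative]; simp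
  rw [h1, ck_chain0, Polynomial.eval_finsetSum]
  refine Finset.sum_congr rfl fun j _ => ?_
  rw [Polynomial.eval_mul, ck_eval_aeval]
  simp [ckLine]

lemma ck_natDegree {n d : ℕ} (x w : Fin (n + 1) → ℝ) (h : MvPolynomial (Fin (n + 1)) ℝ)
    (hh : h.IsHomogeneous d) : (aeval (ckLine x w) h).natDegree ≤ d := by
  have := MvPolynomial.aeval_natDegree_le (m := d) (n := 1) h hh.totalDegree_le (ckLine x w)
    (fun i => by unfold ckLine; compute_degree)
  simpa using this

lemma ck_hom_scale {n d : ℕ} (h : MvPolynomial (Fin (n + 1)) ℝ) (hh : h.IsHomogeneous d)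
    (c : ℝ) (y : Fin (n + 1) → ℝ) : eval (fun j => c * y j) h = c ^ d * eval y h := by
  rw [eval_eq, eval_eq, Finset.mul_sum]
  refine Finset.sum_congr rfl fun m hm => ?_
  have hd : ∑ i ∈ m.support, m i = d := by
    have := hh.degree_eq_sum_deg_support hm
    rw [this]
  rw [← hd, ← Finset.prod_pow_eq_pow_sum]
  simp only [mul_pow, Finset.prod_mul_distrib]
  ring

lemma ck_binary {n d : ℕ} (x w : Fin (n + 1) → ℝ) (h : MvPolynomial (Fin (n + 1)) ℝ)
    (hh : h.IsHomogeneous d) (c s : ℝ) :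
    eval (fun j => c * x j + s * w j) h =
      ∑ k ∈ Finset.range (d + 1), (aeval (ckLine x w) h).coeff k * (c ^ (d - k) * s ^ k) := by
  have key : (fun c : ℝ => eval (fun j => c * x j + s * w j) h) =
      fun c => ∑ k ∈ Finset.range (d + 1),
        (aeval (ckLine x w) h).coeff k * (c ^ (d - k) * s ^ k) := by
    refine Continuous.ext_on (dense_compl_singleton (0 : ℝ)) ?_ (by fun_prop) ?_
    · exact (MvPolynomial.continuous_eval h).comp (by fun_prop)
    · intro c hc
      have hc : c ≠ 0 := hc
      have e : (fun j => c * x j + s * w j) = fun j => c * (x j + (s / c) * w j) := by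
        funext j; field_simp
      simp only
      rw [e, ck_hom_scale h hh, ← ck_eval_aeval,
        Polynomial.eval_eq_sum_range' (Nat.lt_succ_of_le (ck_natDegree x w h hh)), Finset.mul_sum]
      refine Finset.sum_congr rfl fun k hk => ?_
      have hk : k ≤ d := by simpa [Nat.lt_succ_iff] using hk
      have : c ^ d = c ^ (d - k) * c ^ k := by rw [← pow_add]; congr 1; omega
      rw [this, div_pow]; field_simp
  exact congrFun key c

/-- Bernstein–Kellogg for unit tangent vectors. -/
lemma ck_kellogg1 {n d : ℕ} (hd : 1 ≤ d) (h : MvPolynomial (Fin (n + 1)) ℝ)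
    (hh : h.IsHomogeneous d) (x w : Fin (n + 1) → ℝ) (M : ℝ)
    (hM : ∀ c s : ℝ, c ^ 2 + s ^ 2 = 1 → |eval (fun j => c * x j + s * w j) h| ≤ M) :
    |∑ j, w j * eval x (pderiv j h)| ≤ d * M := by
  obtain ⟨m, rfl⟩ : ∃ m, d = m + 1 := ⟨d - 1, by omega⟩
  set a := fun k => (aeval (ckLine x w) h).coeff k with ha
  set P : Polynomial ℝ := ∑ k ∈ Finset.range (m + 1 + 1), if Odd k then
    Polynomial.C (a k) * (Polynomial.X ^ (m + 1 - k) * (1 - Polynomial.X ^ 2) ^ ((k - 1) / 2))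
    else 0 with hPdef
  have hdeg : P.degree ≤ m := by
    rw [hPdef]
    refine (Polynomial.degree_sum_le _ _).trans (Finset.sup_le fun k hk => ?_)
    have hk : k ≤ m + 1 := by simpa [Nat.lt_succ_iff] using hk
    split_ifs with ho
    · apply Polynomial.degree_le_of_natDegree_le
      obtain ⟨l, rfl⟩ := ho
      have h2 : (1 - Polynomial.X ^ 2 : Polynomial ℝ).natDegree ≤ 2 := by compute_degree
      refine (Polynomial.natDegree_C_mul_le _ _).trans
        ((Polynomial.natDegree_mul_le).trans ?_)
      have h3 := Polynomial.natDegree_pow_le_of_le ((2 * l + 1 - 1) / 2) h2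
      have h4 := Polynomial.natDegree_X_pow_le (R := ℝ) (m + 1 - (2 * l + 1))
      have : (2 * l + 1 - 1) / 2 = l := by omega
      rw [this] at h3 ⊢
      omega
    · simp
  have hval : ∀ c s : ℝ, c ^ 2 + s ^ 2 = 1 → s * P.eval c =
      (eval (fun j => c * x j + s * w j) h - eval (fun j => c * x j + (-s) * w j) h) / 2 := by
    intro c s hcs
    rw [ck_binary x w h hh, ck_binary x w h hh, ← Finset.sum_sub_distrib, Finset.sum_div, hPdef,
      Polynomial.eval_finsetSum, Finset.mul_sum]
    refine Finset.sum_congr rfl fun k hk => ?_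
    split_ifs with ho
    · obtain ⟨l, rfl⟩ := ho
      have : (2 * l + 1 - 1) / 2 = l := by omega
      rw [this]
      have hs : 1 - c ^ 2 = s ^ 2 := by linarith
      simp only [Polynomial.eval_mul, Polynomial.eval_C, Polynomial.eval_pow, Polynomial.eval_X,
        Polynomial.eval_sub, Polynomial.eval_one, hs, ha]
      rw [Odd.neg_pow ⟨l, rfl⟩]
      ring
    · rw [Nat.not_odd_iff_even] at ho
      rw [ho.neg_pow]; simp
  have hone : P.eval 1 = a 1 := by
    rw [hPdef, Polynomial.eval_finsetSum, Finset.sum_eq_single 1]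
    · simp
    · intro k _ hk1
      split_ifs with ho
      · obtain ⟨l, rfl⟩ := ho
        have : (2 * l + 1 - 1) / 2 = l := by omega
        rw [this]
        have : l ≠ 0 := by omega
        simp [this]
      · simp
    · simp
  have := ck_schur m P hdeg M (fun θ => by
    rw [hval _ _ (by rw [add_comm]; exact Real.sin_sq_add_cos_sq θ)]
    have h1 := hM (Real.cos θ) (Real.sin θ) (by rw [add_comm]; exact Real.sin_sq_add_cos_sq θ)
    have h2 := hM (Real.cos θ) (-Real.sin θ)
      (by rw [add_comm, neg_sq]; exact Real.sin_sq_add_cos_sq θ)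
    rw [abs_le] at *
    constructor <;> linarith [h1.1, h1.2, h2.1, h2.2])
  have e1 : a 1 = _ := ck_coeff_one x w h
  rw [hone, e1] at this
  push_cast
  exact this

lemma ck_vnorm_nonneg {m : ℕ} (v : Fin m → ℝ) : 0 ≤ vnorm v := Real.sqrt_nonneg _

lemma ck_vnorm_sq {m : ℕ} (v : Fin m → ℝ) : vnorm v ^ 2 = ∑ j, v j ^ 2 :=
  Real.sq_sqrt (Finset.sum_nonneg fun _ _ => sq_nonneg _)

lemma ck_vnorm_eq_one {m : ℕ} (v : Fin m → ℝ) : vnorm v = 1 ↔ ∑ j, v j ^ 2 = 1 := by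
  unfold vnorm; rw [Real.sqrt_eq_one]

lemma ck_vnorm_smul {m : ℕ} (c : ℝ) (v : Fin m → ℝ) :
    vnorm (fun j => c * v j) = |c| * vnorm v := by
  unfold vnorm
  simp only [mul_pow]
  rw [← Finset.mul_sum, Real.sqrt_mul (sq_nonneg _), Real.sqrt_sq_eq_abs]

lemma ck_vnorm_zero_iff {m : ℕ} (v : Fin m → ℝ) : vnorm v = 0 ↔ v = 0 := by
  unfold vnorm
  rw [Real.sqrt_eq_zero (Finset.sum_nonneg fun _ _ => sq_nonneg _),
    Finset.sum_eq_zero_iff_of_nonneg (fun _ _ => sq_nonneg _)]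
  constructor
  · intro h; funext j; simpa using h j (Finset.mem_univ _)
  · intro h; simp [h]

lemma ck_cs {m : ℕ} (v w : Fin m → ℝ) : |∑ j, v j * w j| ≤ vnorm v * vnorm w := by
  apply abs_le_of_sq_le_sq _ (mul_nonneg (ck_vnorm_nonneg _) (ck_vnorm_nonneg _))
  rw [mul_pow, ck_vnorm_sq, ck_vnorm_sq]
  exact Finset.sum_mul_sq_le_sq_mul_sq _ _ _

lemma ck_abs_le_vnorm {m : ℕ} (v : Fin m → ℝ) (i : Fin m) : |v i| ≤ vnorm v := by
  apply Real.abs_le_sqrt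
  exact Finset.single_le_sum (f := fun j => v j ^ 2) (fun _ _ => sq_nonneg _) (Finset.mem_univ i)

lemma ck_bdd {n q : ℕ} (f : Fin q → MvPolynomial (Fin (n + 1)) ℝ) :
    ∃ B : ℝ, ∀ x : Fin (n + 1) → ℝ, vnorm x = 1 → ∀ i, |eval x (f i)| ≤ B := by
  have hK : IsCompact (Set.pi Set.univ (fun _ : Fin (n + 1) => Set.Icc (-1 : ℝ) 1)) :=
    isCompact_univ_pi fun _ => isCompact_Icc
  have hi : ∀ i, ∃ B : ℝ, ∀ x : Fin (n + 1) → ℝ, vnorm x = 1 → |eval x (f i)| ≤ B := by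
    intro i
    obtain ⟨B, hB⟩ := hK.exists_bound_of_continuousOn (f := fun x => eval x (f i))
      (MvPolynomial.continuous_eval (f i)).continuousOn
    refine ⟨B, fun x hx => hB x ?_⟩
    intro j _
    exact abs_le.mp (hx ▸ ck_abs_le_vnorm x j)
  choose B hB using hi
  refine ⟨∑ i, |B i|, fun x hx i => (hB i x hx).trans ((le_abs_self _).trans ?_)⟩
  exact Finset.single_le_sum (f := fun j => |B j|) (fun _ _ => abs_nonneg _) (Finset.mem_univ i)

lemma ck_le_sup {n q : ℕ} (f : Fin q → MvPolynomial (Fin (n + 1)) ℝ)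
    (x : Fin (n + 1) → ℝ) (hx : vnorm x = 1) (i : Fin q) :
    |eval x (f i)| ≤ polySupNorm f := by
  obtain ⟨B, hB⟩ := ck_bdd f
  have h1 : |eval x (f i)| ≤ ⨆ i : Fin q, |eval x (f i)| :=
    le_ciSup (f := fun i => |eval x (f i)|) (Set.finite_range _).bddAbove i
  have h2 : BddAbove (Set.range fun x : {x : Fin (n + 1) → ℝ // vnorm x = 1} =>
      ⨆ i : Fin q, |eval x.1 (f i)|) := by
    refine ⟨B, ?_⟩
    rintro _ ⟨y, rfl⟩
    have : Nonempty (Fin q) := ⟨i⟩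
    exact ciSup_le fun j => hB y.1 y.2 j
  exact h1.trans (le_ciSup h2 ⟨x, hx⟩)

lemma ck_sup_le {n q : ℕ} (f : Fin q → MvPolynomial (Fin (n + 1)) ℝ) (B : ℝ) (hB0 : 0 ≤ B)
    (hB : ∀ x : Fin (n + 1) → ℝ, vnorm x = 1 → ∀ i, |eval x (f i)| ≤ B) :
    polySupNorm f ≤ B :=
  Real.iSup_le (fun x => Real.iSup_le (fun i => hB x.1 x.2 i) hB0) hB0

lemma ck_sup_nonneg {n q : ℕ} (f : Fin q → MvPolynomial (Fin (n + 1)) ℝ) : 0 ≤ polySupNorm f :=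
  Real.iSup_nonneg fun _ => Real.iSup_nonneg fun _ => abs_nonneg _

/-- Kellogg's inequality. -/
lemma ck_kellogg {n q : ℕ} (d : Fin q → ℕ) (hd : ∀ i, 1 ≤ d i)
    (h : Fin q → MvPolynomial (Fin (n + 1)) ℝ) (hh : ∀ i, (h i).IsHomogeneous (d i))
    (x w : Fin (n + 1) → ℝ) (hx : vnorm x = 1) (hw : vnorm w ≤ 1) (hwx : ∑ j, w j * x j = 0)
    (i : Fin q) :
    |(d i : ℝ)⁻¹ * ∑ j, w j * eval x (pderiv j (h i))| ≤ polySupNorm h := by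
  have hdi : (0 : ℝ) < d i := by exact_mod_cast hd i
  have hS := ck_sup_nonneg h
  by_cases h0 : vnorm w = 0
  · rw [ck_vnorm_zero_iff] at h0
    simpa [h0] using hS
  have hwpos : 0 < vnorm w := lt_of_le_of_ne (ck_vnorm_nonneg w) (Ne.symm h0)
  set e : Fin (n + 1) → ℝ := fun j => (vnorm w)⁻¹ * w j with he
  have hen : vnorm e = 1 := by
    rw [he, ck_vnorm_smul, abs_of_pos (inv_pos.mpr hwpos), inv_mul_cancel₀ h0]
  have hex : ∑ j, e j * x j = 0 := by
    simp only [he, mul_assoc]; rw [← Finset.mul_sum, hwx, mul_zero]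
  have key := ck_kellogg1 (hd i) (h i) (hh i) x e (polySupNorm h) (by
    intro c s hcs
    apply ck_le_sup h
    rw [ck_vnorm_eq_one] at hx hen ⊢
    have : ∀ j, (c * x j + s * e j) ^ 2 = c ^ 2 * x j ^ 2 + 2 * c * s * (e j * x j) + s ^ 2 * e j ^ 2 :=
      fun j => by ring
    simp only [this, Finset.sum_add_distrib, ← Finset.mul_sum, hx, hen, hex]
    linarith)
  have e2 : ∑ j, w j * eval x (pderiv j (h i)) =
      vnorm w * ∑ j, e j * eval x (pderiv j (h i)) := by
    rw [Finset.mul_sum]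
    refine Finset.sum_congr rfl fun j _ => ?_
    simp only [he]; field_simp
  rw [e2, abs_mul, abs_mul, abs_of_pos (inv_pos.mpr hdi), abs_of_pos hwpos]
  rw [inv_mul_le_iff₀ hdi]
  calc _ ≤ 1 * |∑ j, e j * eval x (pderiv j (h i))| := by gcongr
    _ ≤ _ := by rw [one_mul]; exact key

lemma ck_sum_abs_le {q : ℕ} (u b : Fin q → ℝ) (hu : vnorm u = 1) (B : ℝ) (hB0 : 0 ≤ B)
    (hb : ∀ i, |b i| ≤ B) : vnorm b ≤ Real.sqrt q * B ∧ |∑ i, u i * b i| ≤ Real.sqrt q * B := by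
  have h1 : vnorm b ≤ Real.sqrt q * B := by
    unfold vnorm
    rw [← Real.sqrt_sq hB0, ← Real.sqrt_mul (by positivity)]
    apply Real.sqrt_le_sqrt
    calc ∑ j, b j ^ 2 ≤ ∑ _j : Fin q, B ^ 2 := Finset.sum_le_sum fun j _ => by
          rw [← sq_abs (b j)]; exact pow_le_pow_left₀ (abs_nonneg _) (hb j) 2
      _ = q * B ^ 2 := by simp
  refine ⟨h1, (ck_cs u b).trans ?_⟩
  rw [hu, one_mul]; exact h1

lemma ck_lower {n q : ℕ} (d : Fin q → ℕ) (hd : ∀ i, 1 ≤ d i)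
    (f g : Fin q → MvPolynomial (Fin (n + 1)) ℝ) (hf : ∀ i, (f i).IsHomogeneous (d i))
    (x : Fin (n + 1) → ℝ) (hx : vnorm x = 1) (hg : g ∈ SingularAt d x) :
    Phi d x f ≤ Real.sqrt q * polySupNorm (fun i => f i - g i) := by
  obtain ⟨hgh, hg0, u, hu0, hu⟩ := hg
  set h : Fin q → MvPolynomial (Fin (n + 1)) ℝ := fun i => f i - g i with hh
  have hhh : ∀ i, (h i).IsHomogeneous (d i) := fun i => (hf i).sub (hgh i)
  have hS := ck_sup_nonneg h
  set u₁ : Fin q → ℝ := fun i => d i * u i with hu1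
  have hu1n : vnorm u₁ ≠ 0 := by
    rw [Ne, ck_vnorm_zero_iff]
    intro hz
    apply hu0
    funext i
    have hi := congrFun hz i
    have : (d i : ℝ) ≠ 0 := by have := hd i; positivity
    simpa [hu1, this] using hi
  have hpos : 0 < vnorm u₁ := lt_of_le_of_ne (ck_vnorm_nonneg _) (Ne.symm hu1n)
  set e : Fin q → ℝ := fun i => (vnorm u₁)⁻¹ * u₁ i with he
  have hen : vnorm e = 1 := by
    rw [he, ck_vnorm_smul, abs_of_pos (inv_pos.mpr hpos), inv_mul_cancel₀ hu1n]
  apply max_le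
  · refine (ck_sum_abs_le e _ hen _ hS ?_).1
    intro i
    have : eval x (f i) = eval x (h i) := by simp [hh, hg0 i]
    rw [this]; exact ck_le_sup h x hx i
  · refine (ciInf_le ⟨0, ?_⟩ (⟨e, hen⟩ : {u : Fin q → ℝ // vnorm u = 1})).trans ?_
    · rintro _ ⟨u, rfl⟩
      exact Real.iSup_nonneg fun _ => abs_nonneg _
    · refine Real.iSup_le ?_ (by positivity)
      rintro ⟨w, hw1, hw2⟩
      simp only
      have hz : ∑ i, e i * ((d i : ℝ)⁻¹ * ∑ j, w j * eval x (pderiv j (g i))) = 0 := by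
        have : ∀ i, e i * ((d i : ℝ)⁻¹ * ∑ j, w j * eval x (pderiv j (g i))) =
            (vnorm u₁)⁻¹ * (u i * ∑ j, w j * eval x (pderiv j (g i))) := by
          intro i
          have : (d i : ℝ) ≠ 0 := by have := hd i; positivity
          simp only [he, hu1]; field_simp
        rw [Finset.sum_congr rfl fun i _ => this i, ← Finset.mul_sum, hu w hw2, mul_zero]
      have hfh : ∑ i, e i * ((d i : ℝ)⁻¹ * ∑ j, w j * eval x (pderiv j (f i))) =
          ∑ i, e i * ((d i : ℝ)⁻¹ * ∑ j, w j * eval x (pderiv j (h i))) := by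
        rw [← sub_zero (∑ i, e i * ((d i : ℝ)⁻¹ * ∑ j, w j * eval x (pderiv j (f i)))), ← hz,
          ← Finset.sum_sub_distrib]
        refine Finset.sum_congr rfl fun i _ => ?_
        simp only [hh, map_sub, mul_sub, Finset.sum_sub_distrib]
      rw [hfh]
      exact (ck_sum_abs_le e _ hen _ hS
        (fun i => ck_kellogg d hd h hhh x w hx hw1 hw2 i)).2

/-- The linear form `⟨a, X⟩`. -/
noncomputable def ckLin {n : ℕ} (a : Fin (n + 1) → ℝ) : MvPolynomial (Fin (n + 1)) ℝ :=
  ∑ j, C (a j) * X j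

lemma ck_lin_hom {n : ℕ} (a : Fin (n + 1) → ℝ) : (ckLin a).IsHomogeneous 1 :=
  IsHomogeneous.sum _ _ _ fun j _ => isHomogeneous_C_mul_X _ _

lemma ck_lin_eval {n : ℕ} (a y : Fin (n + 1) → ℝ) : eval y (ckLin a) = ∑ j, a j * y j := by
  simp [ckLin]

/-- Directional derivative. -/
noncomputable def ckD {n : ℕ} (x w : Fin (n + 1) → ℝ) (p : MvPolynomial (Fin (n + 1)) ℝ) : ℝ :=
  ∑ j, w j * eval x (pderiv j p)

lemma ckD_mul {n : ℕ} (x w : Fin (n + 1) → ℝ) (p r : MvPolynomial (Fin (n + 1)) ℝ) :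
    ckD x w (p * r) = ckD x w p * eval x r + eval x p * ckD x w r := by
  unfold ckD
  rw [Finset.sum_mul, Finset.mul_sum, ← Finset.sum_add_distrib]
  refine Finset.sum_congr rfl fun j _ => ?_
  rw [Derivation.leibniz]
  simp
  ring

lemma ckD_add {n : ℕ} (x w : Fin (n + 1) → ℝ) (p r : MvPolynomial (Fin (n + 1)) ℝ) :
    ckD x w (p + r) = ckD x w p + ckD x w r := by
  simp [ckD, mul_add, Finset.sum_add_distrib]

lemma ckD_sub {n : ℕ} (x w : Fin (n + 1) → ℝ) (p r : MvPolynomial (Fin (n + 1)) ℝ) :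
    ckD x w (p - r) = ckD x w p - ckD x w r := by
  simp [ckD, mul_sub, Finset.sum_sub_distrib]

lemma ckD_C {n : ℕ} (x w : Fin (n + 1) → ℝ) (a : ℝ) : ckD x w (C a) = 0 := by
  simp [ckD]

lemma ckD_X {n : ℕ} (x w : Fin (n + 1) → ℝ) (i : Fin (n + 1)) : ckD x w (X i) = w i := by
  unfold ckD
  rw [Finset.sum_eq_single i]
  · simp
  · intro j _ hj
    rw [pderiv_X, Pi.single_apply, if_neg (Ne.symm hj)]; simp
  · simp

lemma ckD_lin {n : ℕ} (x w a : Fin (n + 1) → ℝ) : ckD x w (ckLin a) = ∑ j, a j * w j := by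
  have hs : ∀ s : Finset (Fin (n + 1)), ckD x w (∑ j ∈ s, C (a j) * X j) = ∑ j ∈ s, a j * w j := by
    intro s
    induction s using Finset.induction_on with
    | empty => simpa using ckD_C x w 0
    | insert i s hi ih =>
      rw [Finset.sum_insert hi, Finset.sum_insert hi, ckD_add, ih, ckD_mul, ckD_C, ckD_X]
      simp
  exact hs _

/-- Real and imaginary parts of `(c + i s)^k`. -/
noncomputable def ckRI {n : ℕ} (c s : MvPolynomial (Fin (n + 1)) ℝ) :
    ℕ → MvPolynomial (Fin (n + 1)) ℝ × MvPolynomial (Fin (n + 1)) ℝ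
  | 0 => (1, 0)
  | k + 1 => (c * (ckRI c s k).1 - s * (ckRI c s k).2, c * (ckRI c s k).2 + s * (ckRI c s k).1)

lemma ckRI_hom {n : ℕ} (c s : MvPolynomial (Fin (n + 1)) ℝ) (hc : c.IsHomogeneous 1)
    (hs : s.IsHomogeneous 1) (k : ℕ) :
    (ckRI c s k).1.IsHomogeneous k ∧ (ckRI c s k).2.IsHomogeneous k := by
  induction k with
  | zero => exact ⟨isHomogeneous_one _ _, isHomogeneous_zero _ _ _⟩
  | succ k ih =>
    simp only [ckRI]
    rw [add_comm k 1]
    exact ⟨(hc.mul ih.1).sub (hs.mul ih.2), (hc.mul ih.2).add (hs.mul ih.1)⟩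

lemma ckRI_norm {n : ℕ} (c s : MvPolynomial (Fin (n + 1)) ℝ) (y : Fin (n + 1) → ℝ) (k : ℕ) :
    eval y (ckRI c s k).1 ^ 2 + eval y (ckRI c s k).2 ^ 2 = (eval y c ^ 2 + eval y s ^ 2) ^ k := by
  induction k with
  | zero => simp [ckRI]
  | succ k ih =>
    rw [pow_succ (eval y c ^ 2 + eval y s ^ 2), ← ih]
    simp only [ckRI, map_sub, map_add, map_mul]
    ring

lemma ckRI_at {n : ℕ} (c s : MvPolynomial (Fin (n + 1)) ℝ) (x w : Fin (n + 1) → ℝ)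
    (hc : eval x c = 1) (hs : eval x s = 0) (hcw : ckD x w c = 0) (k : ℕ) :
    eval x (ckRI c s k).1 = 1 ∧ eval x (ckRI c s k).2 = 0 ∧
    ckD x w (ckRI c s k).1 = 0 ∧ ckD x w (ckRI c s k).2 = k * ckD x w s := by
  induction k with
  | zero =>
    have h0 := ckD_C x w 0
    have h1 := ckD_C x w 1
    simp only [map_zero, map_one] at h0 h1
    simp [ckRI, h0, h1]
  | succ k ih =>
    obtain ⟨h1, h2, h3, h4⟩ := ih
    simp only [ckRI, map_sub, map_add, map_mul, ckD_add, ckD_sub, ckD_mul, h1, h2, h3, h4, hc, hs,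
      hcw]
    push_cast
    refine ⟨by ring, by ring, by ring, by ring⟩

lemma ck_bessel {m : ℕ} (x e y : Fin m → ℝ) (hx : vnorm x = 1) (he : vnorm e ≤ 1)
    (hex : ∑ j, e j * x j = 0) (hy : vnorm y = 1) :
    (∑ j, x j * y j) ^ 2 + (∑ j, e j * y j) ^ 2 ≤ 1 := by
  set a := ∑ j, x j * y j with ha
  set b := ∑ j, e j * y j with hb
  have he2 : ∑ j, e j ^ 2 ≤ 1 := by
    rw [← ck_vnorm_sq]; exact pow_le_one₀ (ck_vnorm_nonneg _) he
  rw [ck_vnorm_eq_one] at hx hy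
  have h0 : 0 ≤ ∑ j, (y j - a * x j - b * e j) ^ 2 := Finset.sum_nonneg fun _ _ => sq_nonneg _
  have h1 : ∀ j, (y j - a * x j - b * e j) ^ 2 = y j ^ 2 + a ^ 2 * x j ^ 2 + b ^ 2 * e j ^ 2
      - 2 * a * (x j * y j) - 2 * b * (e j * y j) + 2 * a * b * (e j * x j) := fun j => by ring
  simp only [h1, Finset.sum_add_distrib, Finset.sum_sub_distrib, ← Finset.mul_sum, hx, hy, hex,
    ← ha, ← hb] at h0
  nlinarith [sq_nonneg b]

lemma ck_upper {n q : ℕ} (hq : 1 ≤ q) (d : Fin q → ℕ) (hd : ∀ i, 1 ≤ d i)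
    (f : Fin q → MvPolynomial (Fin (n + 1)) ℝ) (hf : ∀ i, (f i).IsHomogeneous (d i))
    (x : Fin (n + 1) → ℝ) (hx : vnorm x = 1) (ε : ℝ) (hε : 0 < ε) :
    ∃ g ∈ SingularAt d x, polySupNorm (fun i => f i - g i) ≤ 2 * Phi d x f + ε := by
  have hne : Nonempty {u : Fin q → ℝ // vnorm u = 1} := by
    refine ⟨⟨fun i => if i = ⟨0, hq⟩ then 1 else 0, ?_⟩⟩
    rw [ck_vnorm_eq_one]; simp
  obtain ⟨⟨u, hu⟩, hlt⟩ := exists_lt_of_ciInf_lt (show sigmaMin d x f < sigmaMin d x f + ε by linarith)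
  simp only at hlt
  set v : Fin (n + 1) → ℝ := fun j => ∑ i, u i * ((d i : ℝ)⁻¹ * eval x (pderiv j (f i))) with hv
  have hvw : ∀ w : Fin (n + 1) → ℝ,
      ∑ i, u i * ((d i : ℝ)⁻¹ * ∑ j, w j * eval x (pderiv j (f i))) = ∑ j, v j * w j := by
    intro w
    simp only [hv, Finset.mul_sum, Finset.sum_mul]
    rw [Finset.sum_comm]
    exact Finset.sum_congr rfl fun j _ => Finset.sum_congr rfl fun i _ => by ring
  set a := ∑ j, v j * x j with ha
  set v' : Fin (n + 1) → ℝ := fun j => v j - a * x j with hv'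
  have hx2 : ∑ j, x j ^ 2 = 1 := (ck_vnorm_eq_one x).mp hx
  have hv'x : ∑ j, v' j * x j = 0 := by
    have : ∀ j, v' j * x j = v j * x j - a * x j ^ 2 := fun j => by simp only [hv']; ring
    simp only [this, Finset.sum_sub_distrib, ← Finset.mul_sum, hx2, ← ha]; ring
  have hv'w : ∀ w : Fin (n + 1) → ℝ, ∑ j, w j * x j = 0 →
      ∑ j, v' j * w j = ∑ j, v j * w j := by
    intro w hw
    have : ∀ j, v' j * w j = v j * w j - a * (w j * x j) := fun j => by simp only [hv']; ring
    simp only [this, Finset.sum_sub_distrib, ← Finset.mul_sum, hw]; ring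
  set τ := vnorm v' with hτ
  have hτ0 : 0 ≤ τ := ck_vnorm_nonneg _
  set e : Fin (n + 1) → ℝ := fun j => τ⁻¹ * v' j with he
  have hen : vnorm e ≤ 1 := by
    rw [he, ck_vnorm_smul, abs_of_nonneg (inv_nonneg.mpr hτ0), ← hτ]
    exact inv_mul_le_one
  have hex : ∑ j, e j * x j = 0 := by
    simp only [he, mul_assoc]; rw [← Finset.mul_sum, hv'x, mul_zero]
  have hτe : ∀ j, τ * e j = v' j := by
    intro j
    by_cases h0 : τ = 0
    · have := (ck_vnorm_zero_iff v').mp h0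
      simp [h0, this]
    · simp only [he]; field_simp
  have hve : ∑ j, v j * e j = τ := by
    rw [← hv'w e hex]
    by_cases h0 : τ = 0
    · have := (ck_vnorm_zero_iff v').mp h0
      simp [h0, this]
    · have h1 : ∀ j, v' j * e j = τ⁻¹ * v' j ^ 2 := fun j => by simp only [he]; ring
      simp only [h1, ← Finset.mul_sum]
      rw [← ck_vnorm_sq, ← hτ]; field_simp
  have hτle : τ ≤ sigmaMin d x f + ε := by
    refine le_trans ?_ hlt.le
    have hb : BddAbove (Set.range fun w : {w : Fin (n + 1) → ℝ // vnorm w ≤ 1 ∧ ∑ j, w j * x j = 0} =>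
        |∑ i, u i * ((d i : ℝ)⁻¹ * ∑ j, w.1 j * eval x (pderiv j (f i)))|) := by
      refine ⟨vnorm v, ?_⟩
      rintro _ ⟨w, rfl⟩
      simp only
      rw [hvw]
      refine (ck_cs v w.1).trans ?_
      exact mul_le_of_le_one_right (ck_vnorm_nonneg _) w.2.1
    refine le_trans ?_ (le_ciSup hb ⟨e, hen, hex⟩)
    simp only
    rw [hvw, hve]; exact le_abs_self _
  set c := ckLin x with hc
  set s := ckLin e with hs
  set h : Fin q → MvPolynomial (Fin (n + 1)) ℝ := fun i =>
    C (eval x (f i)) * (ckRI c s (d i)).1 + C (u i * τ) * (ckRI c s (d i)).2 with hh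
  have hcx : eval x c = 1 := by rw [hc, ck_lin_eval, ← hx2]; simp [sq]
  have hsx : eval x s = 0 := by rw [hs, ck_lin_eval, hex]
  have hhom := fun i => ckRI_hom c s (ck_lin_hom _) (ck_lin_hom _) (d i)
  refine ⟨fun i => f i - h i, ⟨fun i => ?_, fun i => ?_, fun i => u i * (d i : ℝ)⁻¹, ?_, ?_⟩, ?_⟩
  · exact (hf i).sub (((hhom i).1.C_mul _).add ((hhom i).2.C_mul _))
  · have h1 := ckRI_at c s x 0 hcx hsx (by simp [ckD]) (d i)
    simp [hh, h1.1, h1.2.1]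
  · intro hz
    have : u = 0 := by
      funext i
      have hi := congrFun hz i
      have : (d i : ℝ) ≠ 0 := by have := hd i; positivity
      have hd0 : d i ≠ 0 := by have := hd i; omega
      simpa [this, hd0] using hi
    rw [(ck_vnorm_zero_iff u).mpr this] at hu
    exact zero_ne_one hu
  · intro w hw
    have hcw : ckD x w c = 0 := by
      rw [hc, ckD_lin, ← hw]; exact Finset.sum_congr rfl fun j _ => mul_comm _ _
    have hDs : τ * ckD x w s = ∑ j, v j * w j := by
      rw [hs, ckD_lin, ← hv'w w hw, Finset.mul_sum]
      exact Finset.sum_congr rfl fun j _ => by rw [← mul_assoc, hτe]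
    have hi : ∀ i, u i * (d i : ℝ)⁻¹ * ∑ j, w j * eval x (pderiv j (f i - h i)) =
        u i * ((d i : ℝ)⁻¹ * ∑ j, w j * eval x (pderiv j (f i))) -
          u i ^ 2 * ∑ j, v j * w j := by
      intro i
      have h1 := ckRI_at c s x w hcx hsx hcw (d i)
      have hd0 : (d i : ℝ) ≠ 0 := by have := hd i; positivity
      change u i * (d i : ℝ)⁻¹ * ckD x w (f i - h i) = u i * ((d i : ℝ)⁻¹ * ckD x w (f i)) - _
      rw [ckD_sub, hh]
      simp only [ckD_add, ckD_mul, ckD_C, h1.2.2.1, h1.2.2.2, eval_C]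
      rw [← hDs]
      field_simp
      ring
    simp only [hi, Finset.sum_sub_distrib, hvw, ← Finset.sum_mul, (ck_vnorm_eq_one u).mp hu]
    ring
  · have hΦ0 : 0 ≤ Phi d x f := (ck_vnorm_nonneg _).trans (le_max_left _ _)
    refine ck_sup_le _ _ (by linarith) ?_
    intro y hy i
    have hb := ck_bessel x e y hx hen hex hy
    have hn := ckRI_norm c s y (d i)
    have hle : (eval y c ^ 2 + eval y s ^ 2) ^ (d i) ≤ 1 := by
      apply pow_le_one₀ (by positivity)
      rw [hc, hs, ck_lin_eval, ck_lin_eval]; exact hb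
    have hR : |eval y (ckRI c s (d i)).1| ≤ 1 := by
      rw [← sq_le_one_iff_abs_le_one]; nlinarith [sq_nonneg (eval y (ckRI c s (d i)).2)]
    have hI : |eval y (ckRI c s (d i)).2| ≤ 1 := by
      rw [← sq_le_one_iff_abs_le_one]; nlinarith [sq_nonneg (eval y (ckRI c s (d i)).1)]
    have e1 : eval y (f i - (f i - h i)) = eval x (f i) * eval y (ckRI c s (d i)).1 +
        u i * τ * eval y (ckRI c s (d i)).2 := by
      simp [hh]
    rw [e1]
    have f1 : |eval x (f i)| ≤ Phi d x f :=
      (ck_abs_le_vnorm (fun i => eval x (f i)) i).trans (le_max_left _ _)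
    have f2 : |u i| ≤ 1 := hu ▸ ck_abs_le_vnorm u i
    have f3 : τ ≤ Phi d x f + ε := hτle.trans (by gcongr; exact le_max_right _ _)
    calc _ ≤ |eval x (f i)| * |eval y (ckRI c s (d i)).1| +
          |u i| * τ * |eval y (ckRI c s (d i)).2| := by
          refine (abs_add_le _ _).trans (le_of_eq ?_)
          rw [abs_mul, abs_mul, abs_mul, abs_of_nonneg hτ0]
      _ ≤ |eval x (f i)| * 1 + 1 * τ * 1 := by gcongr
      _ ≤ _ := by linarith

lemma ck_zero_mem {n q : ℕ} (hq : 1 ≤ q) (d : Fin q → ℕ) (x : Fin (n + 1) → ℝ) :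
    (0 : Fin q → MvPolynomial (Fin (n + 1)) ℝ) ∈ SingularAt d x := by
  refine ⟨fun i => isHomogeneous_zero _ _ _, fun i => by simp, fun _ => 1, ?_, by simp⟩
  intro h
  exact one_ne_zero (congrFun h ⟨0, hq⟩)

lemma ck_dist_le {n q : ℕ} (f g : Fin q → MvPolynomial (Fin (n + 1)) ℝ)
    (S : Set (Fin q → MvPolynomial (Fin (n + 1)) ℝ)) (hg : g ∈ S) :
    distInf f S ≤ polySupNorm (fun i => f i - g i) :=
  csInf_le ⟨0, by rintro _ ⟨g, _, rfl⟩; exact ck_sup_nonneg _⟩ ⟨g, hg, rfl⟩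

lemma ck_up {n q : ℕ} (hq : 1 ≤ q) (d : Fin q → ℕ) (hd : ∀ i, 1 ≤ d i)
    (f : Fin q → MvPolynomial (Fin (n + 1)) ℝ) (hf : ∀ i, (f i).IsHomogeneous (d i))
    (x : Fin (n + 1) → ℝ) (hx : vnorm x = 1) (S : Set (Fin q → MvPolynomial (Fin (n + 1)) ℝ))
    (hS : SingularAt d x ⊆ S) :
    Kloc d x f ≤ ENNReal.ofReal (2 * Real.sqrt (∑ i, (d i : ℝ) ^ 2) * polySupNorm f) /
        ENNReal.ofReal (distInf f S) := by
  have h1 : distInf f S ≤ 2 * Phi d x f := by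
    apply le_of_forall_pos_le_add
    intro ε hε
    obtain ⟨g, hg, hle⟩ := ck_upper hq d hd f hf x hx ε hε
    exact (ck_dist_le f g S (hS hg)).trans hle
  have h2 : Real.sqrt q ≤ Real.sqrt (∑ i, (d i : ℝ) ^ 2) := by
    apply Real.sqrt_le_sqrt
    calc (q : ℝ) = ∑ _i : Fin q, (1 : ℝ) := by simp
      _ ≤ _ := Finset.sum_le_sum fun i _ => by
        have : (1 : ℝ) ≤ d i := by exact_mod_cast hd i
        exact one_le_pow₀ this
  have hN := ck_sup_nonneg f
  unfold Kloc
  rw [← ENNReal.mul_div_mul_left (c := 2) _ _ (by simp) (by simp)]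
  have e2 : (2 : ENNReal) = ENNReal.ofReal 2 := by simp
  rw [e2, ← ENNReal.ofReal_mul (by norm_num), ← ENNReal.ofReal_mul (by norm_num)]
  apply ENNReal.div_le_div
  · apply ENNReal.ofReal_le_ofReal
    rw [mul_assoc]; gcongr
  · exact ENNReal.ofReal_le_ofReal h1

lemma ck_low {n q : ℕ} (hq : 1 ≤ q) (d : Fin q → ℕ) (hd : ∀ i, 1 ≤ d i)
    (f : Fin q → MvPolynomial (Fin (n + 1)) ℝ) (hf : ∀ i, (f i).IsHomogeneous (d i))
    (S : Set (Fin q → MvPolynomial (Fin (n + 1)) ℝ)) (hSne : S.Nonempty) (K : ENNReal)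
    (hS : ∀ g ∈ S, ∃ y, vnorm y = 1 ∧ g ∈ SingularAt d y ∧ Kloc d y f ≤ K) :
    ENNReal.ofReal (polySupNorm f) / ENNReal.ofReal (distInf f S) ≤ K := by
  by_cases hK : K = ⊤
  · simp [hK]
  have hN := ck_sup_nonneg f
  have hqpos : (0 : ℝ) < Real.sqrt q := Real.sqrt_pos.mpr (by exact_mod_cast hq)
  rw [ENNReal.div_le_iff_le_mul (Or.inr hK) (Or.inl ENNReal.ofReal_ne_top)]
  lift K to NNReal using hK
  rw [← ENNReal.ofReal_coe_nnreal, ← ENNReal.ofReal_mul K.coe_nonneg]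
  apply ENNReal.ofReal_le_ofReal
  have key : ∀ g ∈ S, polySupNorm f ≤ K * polySupNorm (fun i => f i - g i) := by
    intro g hg
    obtain ⟨y, hy, hgy, hle⟩ := hS g hg
    have hΦ := ck_lower d hd f g hf y hy hgy
    unfold Kloc at hle
    rw [ENNReal.div_le_iff_le_mul (Or.inr ENNReal.coe_ne_top) (Or.inl ENNReal.ofReal_ne_top),
      ← ENNReal.ofReal_coe_nnreal, ← ENNReal.ofReal_mul K.coe_nonneg] at hle
    have hΦ0 : 0 ≤ Phi d y f := (ck_vnorm_nonneg _).trans (le_max_left _ _)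
    rw [ENNReal.ofReal_le_ofReal_iff (mul_nonneg K.coe_nonneg hΦ0)] at hle
    have h3 : Real.sqrt q * polySupNorm f ≤
        Real.sqrt q * (K * polySupNorm (fun i => f i - g i)) := by
      refine hle.trans ((mul_le_mul_of_nonneg_left hΦ K.coe_nonneg).trans (le_of_eq ?_))
      change (K : ℝ) * _ = _
      ring
    exact le_of_mul_le_mul_left h3 hqpos
  change polySupNorm f ≤ (K : ℝ) * _
  by_cases hK0 : (K : ℝ) = 0
  · obtain ⟨g, hg⟩ := hSne
    have := key g hg
    rw [hK0, zero_mul] at this ⊢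
    exact this
  have hKpos : (0 : ℝ) < K := lt_of_le_of_ne K.coe_nonneg (Ne.symm hK0)
  rw [← div_le_iff₀' hKpos]
  obtain ⟨g, hg⟩ := hSne
  refine le_csInf (s := {t : ℝ | ∃ g ∈ S, t = polySupNorm (fun i => f i - g i)}) ⟨_, g, hg, rfl⟩ ?_
  rintro _ ⟨g, hg, rfl⟩
  rw [div_le_iff₀' hKpos]
  exact key g hg


/-- Proposition 3.4: the condition numbers `K(f,x)` and `K(f)` are bounded above and below
by (multiples of) inverse distances to the corresponding sets of singular systems. -/
theorem condition_number_theorem_K (n q : ℕ) (hn : 1 ≤ n) (hq : 1 ≤ q) (hqn : q ≤ n)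
    (d : Fin q → ℕ) (hd : ∀ i, 1 ≤ d i)
    (f : Fin q → MvPolynomial (Fin (n + 1)) ℝ) (hf : ∀ i, (f i).IsHomogeneous (d i))
    (hf0 : f ≠ 0) (x : Fin (n + 1) → ℝ) (hx : vnorm x = 1) (hΦ : 0 < Phi d x f) :
    (ENNReal.ofReal (polySupNorm f) / ENNReal.ofReal (distInf f (SingularAt d x)) ≤
        Kloc d x f ∧
      Kloc d x f ≤ ENNReal.ofReal (2 * Real.sqrt (∑ i, (d i : ℝ) ^ 2) * polySupNorm f) /
        ENNReal.ofReal (distInf f (SingularAt d x))) ∧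
    (ENNReal.ofReal (polySupNorm f) /
        ENNReal.ofReal (distInf f {g | ∃ y, vnorm y = 1 ∧ g ∈ SingularAt d y}) ≤
        Kglob d f ∧
      Kglob d f ≤ ENNReal.ofReal (2 * Real.sqrt (∑ i, (d i : ℝ) ^ 2) * polySupNorm f) /
        ENNReal.ofReal (distInf f {g | ∃ y, vnorm y = 1 ∧ g ∈ SingularAt d y})) := by
  refine ⟨⟨?_, ?_⟩, ?_, ?_⟩
  · exact ck_low hq d hd f hf _ ⟨0, ck_zero_mem hq d x⟩ _ fun g hg => ⟨x, hx, hg, le_rfl⟩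
  · exact ck_up hq d hd f hf x hx _ subset_rfl
  · refine ck_low hq d hd f hf {g | ∃ y, vnorm y = 1 ∧ g ∈ SingularAt d y}
      ⟨0, x, hx, ck_zero_mem hq d x⟩ _ ?_
    rintro g ⟨y, hy, hg⟩
    exact ⟨y, hy, hg, le_iSup (fun y : {y : Fin (n + 1) → ℝ // vnorm y = 1} => Kloc d y.1 f) ⟨y, hy⟩⟩
  · refine iSup_le fun y => ?_
    exact ck_up hq d hd f hf y.1 y.2 _ fun g hg => ⟨y.1, y.2, hg⟩
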